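/- arXiv:2006.16434 — 3 statements merged into one kernel-verified Lean document; each statement's English description precedes it below -/
import Mathlib

section
/- Let n and m be positive integers and let f₁, …, f_m : ℝⁿ → ℝ be continuously differentiable. If x* ∈ ℝⁿ is Pareto optimal for (f₁, …, f_m), then x* is Pareto stationary: there exists α ∈ ℝ^m with α_i ≥ 0 for all i, Σ_i α_i = 1, and Σ_i α_i ∇f_i(x*) = 0. -/
open Filter Topology in
/-- A direction of negative derivative is a strict descent direction for small positive steps. -/
theorem HasLineDerivAt.eventually_lt_of_neg {E : Type*} [AddCommGroup E] [Module ℝ E]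
    {f : E → ℝ} {f' : ℝ} {x d : E} (h : HasLineDerivAt ℝ f f' x d) (hneg : f' < 0) :
    ∀ᶠ t in 𝓝[>] (0 : ℝ), f (x + t • d) < f x := by
  have hslope := HasDerivAt.tendsto_slope_zero_right h
  filter_upwards [hslope.eventually_lt_const hneg, self_mem_nhdsWithin] with t ht hpos
  have hpos : 0 < t := hpos
  simp only [zero_add, zero_smul, add_zero, smul_eq_mul] at ht
  have := neg_of_mul_neg_right ht (inv_nonneg.mpr hpos.le)
  linarith

/-- **Gordan's alternative**: if no convex combination of the vectors `g i` vanishes, then some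
direction has negative inner product with all of them. -/
theorem exists_forall_inner_neg_of_forall_sum_smul_ne_zero {ι E : Type*} [Fintype ι]
    [NormedAddCommGroup E] [InnerProductSpace ℝ E] [CompleteSpace E] (g : ι → E)
    (hg : ∀ α ∈ stdSimplex ℝ ι, ∑ i, α i • g i ≠ 0) :
    ∃ d : E, ∀ i, inner ℝ (g i) d < 0 := by
  classical
  set S : Set E := Fintype.linearCombination ℝ g '' stdSimplex ℝ ι
  have hconv : Convex ℝ S := (convex_stdSimplex ℝ ι).linear_image _
  have hcomp : IsCompact S := (isCompact_stdSimplex ℝ ι).image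
    (LinearMap.continuous_of_finiteDimensional _)
  have hzero : (0 : E) ∉ S := by
    rintro ⟨α, hα, h⟩
    exact hg α hα (by simpa [Fintype.linearCombination_apply] using h)
  obtain ⟨φ, u, hu, hφ⟩ := geometric_hahn_banach_point_closed hconv hcomp.isClosed hzero
  rw [map_zero] at hu
  refine ⟨-(InnerProductSpace.toDual ℝ E).symm φ, fun i => ?_⟩
  have hi : g i ∈ S := ⟨Pi.single i 1, single_mem_stdSimplex ℝ i, by simp⟩
  rw [inner_neg_right, real_inner_comm, InnerProductSpace.toDual_symm_apply]
  linarith [hφ _ hi]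


/-- If `x*` is Pareto optimal for continuously differentiable
objectives `f₁, …, f_m : ℝⁿ → ℝ`, then `x*` is Pareto stationary. -/
theorem pareto_optimal_implies_pareto_stationary
    (n m : ℕ) (hn : 0 < n) (hm : 0 < m)
    (f : Fin m → EuclideanSpace ℝ (Fin n) → ℝ)
    (hf : ∀ i, ContDiff ℝ 1 (f i))
    (xstar : EuclideanSpace ℝ (Fin n))
    (hpareto : ∀ y : EuclideanSpace ℝ (Fin n),
      ¬ ((∀ i, f i y ≤ f i xstar) ∧ (∃ i, f i y ≠ f i xstar))) :
    ∃ α : Fin m → ℝ, (∀ i, 0 ≤ α i) ∧ (∑ i, α i = 1) ∧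
      (∑ i, α i • gradient (f i) xstar) = 0 := by
  by_contra hstat
  obtain ⟨d, hd⟩ := exists_forall_inner_neg_of_forall_sum_smul_ne_zero
    (fun i => gradient (f i) xstar) fun α hα h0 => hstat ⟨α, hα.1, hα.2, h0⟩
  have hdesc : ∀ i, ∀ᶠ t in nhdsWithin (0 : ℝ) (Set.Ioi 0),
      f i (xstar + t • d) < f i xstar := fun i => by
    have hgrad := ((hf i).differentiable one_ne_zero xstar).hasGradientAt
    exact (hgrad.hasFDerivAt.hasLineDerivAt d).eventually_lt_of_neg
      (by simpa only [InnerProductSpace.toDual_apply_apply] using hd i)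
  obtain ⟨t, ht⟩ := (Filter.eventually_all.mpr hdesc).exists
  exact hpareto (xstar + t • d) ⟨fun i => (ht i).le, ⟨0, hm⟩, (ht _).ne⟩
end

section
/- Let n and m be positive integers and let f₁, …, f_m : ℝⁿ → ℝ be continuously differentiable. If x* ∈ ℝⁿ is locally Pareto optimal for (f₁, …, f_m), then x* is Pareto stationary: there exists α ∈ ℝ^m with α_i ≥ 0 for all i, Σ_i α_i = 1, and Σ_i α_i ∇f_i(x*) = 0. -/
/-- **Gordan's alternative**: if no vector has negative inner product with all of the finitely many
vectors `v i`, then zero is a convex combination of the `v i`. -/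
theorem exists_mem_stdSimplex_sum_smul_eq_zero {ι E : Type*} [Fintype ι]
    [NormedAddCommGroup E] [InnerProductSpace ℝ E] [CompleteSpace E] (v : ι → E)
    (h : ∀ d, ∃ i, 0 ≤ inner ℝ (v i) d) :
    ∃ α ∈ stdSimplex ℝ ι, ∑ i, α i • v i = 0 := by
  classical
  by_contra! hα
  let L : (ι → ℝ) →ₗ[ℝ] E := Fintype.linearCombination ℝ v
  have hcont : Continuous L := L.continuous_of_finiteDimensional
  have hzero : (0 : E) ∉ L '' stdSimplex ℝ ι := by
    rintro ⟨α, hmem, hL⟩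
    exact hα α hmem (by simpa [L, Fintype.linearCombination_apply] using hL)
  obtain ⟨φ, u, hu, hφ⟩ := geometric_hahn_banach_point_closed
    ((convex_stdSimplex ℝ ι).linear_image L)
    ((isCompact_stdSimplex ℝ ι).image hcont).isClosed hzero
  obtain ⟨i, hi⟩ := h (-(InnerProductSpace.toDual ℝ E).symm φ)
  have hvi : u < φ (v i) :=
    hφ _ ⟨Pi.single i 1, single_mem_stdSimplex ℝ i, by simp [L, Fintype.linearCombination_apply]⟩
  rw [inner_neg_right, real_inner_comm, InnerProductSpace.toDual_symm_apply] at hi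
  rw [map_zero] at hu
  linarith

/-- A function decreases strictly along any direction in which its derivative is negative. -/
theorem HasFDerivAt.eventually_lt_of_apply_neg {E : Type*} [NormedAddCommGroup E]
    [NormedSpace ℝ E] {f : E → ℝ} {f' : StrongDual ℝ E} {x d : E} (hf : HasFDerivAt f f' x)
    (hd : f' d < 0) : ∀ᶠ t : ℝ in nhdsWithin 0 (Set.Ioi 0), f (x + t • d) < f x := by
  have hderiv : HasDerivAt (fun t : ℝ => f (x + t • d)) (f' d) 0 := hf.hasLineDerivAt d
  have hslope := (hasDerivAt_iff_tendsto_slope_zero.1 hderiv).eventually_lt_const hd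
  filter_upwards [hslope.filter_mono (nhdsWithin_mono 0 fun t (ht : 0 < t) => ht.ne'),
    self_mem_nhdsWithin] with t ht (ht0 : 0 < t)
  simp only [zero_add, zero_smul, add_zero, smul_eq_mul] at ht
  have hlt := neg_of_mul_neg_right ht (inv_pos.2 ht0).le
  linarith


/-- If `x*` is locally Pareto optimal for continuously differentiable
objectives `f₁, …, f_m : ℝⁿ → ℝ`, then `x*` is Pareto stationary. -/
theorem locally_pareto_optimal_implies_pareto_stationary
    (n m : ℕ) (hn : 0 < n) (hm : 0 < m)
    (f : Fin m → EuclideanSpace ℝ (Fin n) → ℝ)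
    (hf : ∀ i, ContDiff ℝ 1 (f i))
    (xstar : EuclideanSpace ℝ (Fin n))
    (hpareto : ∃ U ∈ nhds xstar, ∀ y ∈ U,
      ¬ ((∀ i, f i y ≤ f i xstar) ∧ (∃ i, f i y ≠ f i xstar))) :
    ∃ α : Fin m → ℝ, (∀ i, 0 ≤ α i) ∧ (∑ i, α i = 1) ∧
      (∑ i, α i • gradient (f i) xstar) = 0 := by
  obtain ⟨U, hU, hdom⟩ := hpareto
  obtain ⟨α, ⟨hnonneg, hsum⟩, hzero⟩ :=
    exists_mem_stdSimplex_sum_smul_eq_zero (fun i => gradient (f i) xstar) (by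
      by_contra! hd
      obtain ⟨d, hd⟩ := hd
      have hdecr : ∀ᶠ t : ℝ in nhdsWithin 0 (Set.Ioi 0),
          ∀ i, f i (xstar + t • d) < f i xstar :=
        Filter.eventually_all.2 fun i =>
          ((hf i).differentiable one_ne_zero xstar).hasGradientAt.hasFDerivAt
            |>.eventually_lt_of_apply_neg (by simpa using hd i)
      have hcurve : Filter.Tendsto (fun t : ℝ => xstar + t • d)
          (nhdsWithin 0 (Set.Ioi 0)) (nhds xstar) := by
        have hcont : Continuous fun t : ℝ => xstar + t • d := by fun_prop
        simpa using (hcont.tendsto 0).mono_left nhdsWithin_le_nhds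
      obtain ⟨t, ht, htU⟩ := (hdecr.and (hcurve.eventually_mem hU)).exists
      exact hdom _ htU ⟨fun i => (ht i).le, ⟨0, hm⟩, (ht _).ne⟩)
  exact ⟨α, hnonneg, hsum, hzero⟩
end

section
/- Let f = (f₁, f₂) : ℝⁿ → ℝ² be twice continuously differentiable, let x* ∈ ℝⁿ be Pareto optimal with stationarity coefficients α₁, α₂ ≥ 0, α₁ + α₂ = 1, α₁ ∇f₁(x*) + α₂ ∇f₂(x*) = 0, and define H = α₁ ∇²f₁(x*) + α₂ ∇²f₂(x*). Let v ∈ ℝⁿ satisfy H v ≠ 0 and H v ∈ span{∇f₁(x*), ∇f₂(x*)}, and let u ∈ ℝⁿ satisfy H u = 0. For d ∈ ℝⁿ define c_d(t) = f(x* + t d), and assume c_v'(0) ≠ 0 and c_{v+u}'(0) ≠ 0. Then the signed curvatures of the plane curves c_v and c_{v+u} at t = 0 coincide: (c_{v,1}'(0) c_{v,2}''(0) − c_{v,2}'(0) c_{v,1}''(0)) / ‖c_v'(0)‖³ = (c_{v+u,1}'(0) c_{v+u,2}''(0) − c_{v+u,2}'(0) c_{v+u,1}''(0)) / ‖c_{v+u}'(0)‖³.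 -/
section LineDerivatives

variable {E : Type*} [NormedAddCommGroup E] [InnerProductSpace ℝ E]

lemma hasDerivAt_add_smul (x d : E) (t : ℝ) : HasDerivAt (fun s : ℝ => x + s • d) d t := by
  simpa using ((hasDerivAt_id t).smul_const d).const_add x

variable [CompleteSpace E]

lemma ContDiff.differentiable_gradient {f : E → ℝ} (hf : ContDiff ℝ 2 f) :
    Differentiable ℝ (gradient f) :=
  (InnerProductSpace.toDual ℝ E).symm.toContinuousLinearEquiv.differentiable.comp
    ((hf.fderiv_right (m := 1) (by norm_num)).differentiable (by norm_num))

lemma inner_fderiv_gradient {f : E → ℝ} (hf : ContDiff ℝ 2 f) (x a b : E) :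
    inner ℝ (fderiv ℝ (gradient f) x a) b = fderiv ℝ (fderiv ℝ f) x a b := by
  have hd : Differentiable ℝ (fderiv ℝ f) :=
    (hf.fderiv_right (m := 1) (by norm_num)).differentiable (by norm_num)
  have h : HasFDerivAt (gradient f) _ x :=
    ((InnerProductSpace.toDual ℝ E).symm.toContinuousLinearEquiv.hasFDerivAt).comp x
      (hd x).hasFDerivAt
  rw [h.fderiv]
  exact InnerProductSpace.toDual_symm_apply

lemma inner_fderiv_gradient_comm {f : E → ℝ} (hf : ContDiff ℝ 2 f) (x a b : E) :
    inner ℝ (fderiv ℝ (gradient f) x a) b = inner ℝ (fderiv ℝ (gradient f) x b) a := by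
  rw [inner_fderiv_gradient hf, inner_fderiv_gradient hf]
  exact (hf.contDiffAt.isSymmSndFDerivAt (by simp)).eq a b

lemma deriv_comp_add_smul {f : E → ℝ} (hf : Differentiable ℝ f) (x d : E) (t : ℝ) :
    deriv (fun s : ℝ => f (x + s • d)) t = inner ℝ (gradient f (x + t • d)) d := by
  have h := (hf (x + t • d)).hasGradientAt.hasFDerivAt.comp_hasDerivAt t
    (hasDerivAt_add_smul x d t)
  simpa [Function.comp_def] using h.deriv

lemma deriv_deriv_comp_add_smul {f : E → ℝ} (hf : ContDiff ℝ 2 f) (x d : E) :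
    deriv (deriv fun s : ℝ => f (x + s • d)) 0 = inner ℝ (fderiv ℝ (gradient f) x d) d := by
  rw [funext (deriv_comp_add_smul (hf.differentiable (by norm_num)) x d)]
  have h := (hf.differentiable_gradient (x + (0 : ℝ) • d)).hasFDerivAt.comp_hasDerivAt 0
    (hasDerivAt_add_smul x d 0)
  simpa using (h.inner ℝ (hasDerivAt_const 0 d)).deriv

end LineDerivatives


/-- At a Pareto optimal point `x*` of `f = (f₁, f₂)` with stationarity
coefficients `(α₁, α₂)` and `H = α₁ ∇²f₁(x*) + α₂ ∇²f₂(x*)`, if `v` satisfies the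
tangent equation (`H v ≠ 0` and `H v ∈ span{∇f₁(x*), ∇f₂(x*)}`) and `u` is a null
vector of `H`, then the plane curves `c_v(t) = f(x* + t v)` and
`c_{v+u}(t) = f(x* + t (v+u))` have the same signed curvature at `t = 0`. -/
theorem null_vector_preserves_curvature
    (n : ℕ)
    (f₁ f₂ : EuclideanSpace ℝ (Fin n) → ℝ)
    (hf₁ : ContDiff ℝ 2 f₁) (hf₂ : ContDiff ℝ 2 f₂)
    (xstar : EuclideanSpace ℝ (Fin n))
    (hpareto : ∀ y : EuclideanSpace ℝ (Fin n),
      ¬ ((f₁ y ≤ f₁ xstar ∧ f₂ y ≤ f₂ xstar) ∧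
         ((f₁ y, f₂ y) : ℝ × ℝ) ≠ (f₁ xstar, f₂ xstar)))
    (α₁ α₂ : ℝ) (hα₁ : 0 ≤ α₁) (hα₂ : 0 ≤ α₂) (hsum : α₁ + α₂ = 1)
    (hstat : α₁ • gradient f₁ xstar + α₂ • gradient f₂ xstar = 0)
    (H : EuclideanSpace ℝ (Fin n) → EuclideanSpace ℝ (Fin n))
    (hH : ∀ w, H w = α₁ • fderiv ℝ (gradient f₁) xstar w
                    + α₂ • fderiv ℝ (gradient f₂) xstar w)
    (v u : EuclideanSpace ℝ (Fin n))
    (hv : H v ≠ 0)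
    (hvspan : H v ∈ Submodule.span ℝ ({gradient f₁ xstar, gradient f₂ xstar} :
      Set (EuclideanSpace ℝ (Fin n))))
    (hu : H u = 0)
    (c₁ c₂ : EuclideanSpace ℝ (Fin n) → ℝ → ℝ)
    (hc₁ : ∀ d t, c₁ d t = f₁ (xstar + t • d))
    (hc₂ : ∀ d t, c₂ d t = f₂ (xstar + t • d))
    (hcv : (deriv (c₁ v) 0, deriv (c₂ v) 0) ≠ ((0 : ℝ), (0 : ℝ)))
    (hcvu : (deriv (c₁ (v + u)) 0, deriv (c₂ (v + u)) 0) ≠ ((0 : ℝ), (0 : ℝ))) :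
    (deriv (c₁ v) 0 * deriv (deriv (c₂ v)) 0
        - deriv (c₂ v) 0 * deriv (deriv (c₁ v)) 0)
      / (Real.sqrt ((deriv (c₁ v) 0) ^ 2 + (deriv (c₂ v) 0) ^ 2)) ^ 3
    = (deriv (c₁ (v + u)) 0 * deriv (deriv (c₂ (v + u))) 0
        - deriv (c₂ (v + u)) 0 * deriv (deriv (c₁ (v + u))) 0)
      / (Real.sqrt ((deriv (c₁ (v + u)) 0) ^ 2 + (deriv (c₂ (v + u)) 0) ^ 2)) ^ 3 := by
  obtain rfl : c₁ = fun d t => f₁ (xstar + t • d) := by funext d t; exact hc₁ d t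
  obtain rfl : c₂ = fun d t => f₂ (xstar + t • d) := by funext d t; exact hc₂ d t
  simp only [deriv_deriv_comp_add_smul hf₁, deriv_deriv_comp_add_smul hf₂,
    deriv_comp_add_smul (hf₁.differentiable two_ne_zero),
    deriv_comp_add_smul (hf₂.differentiable two_ne_zero), zero_smul, add_zero]
  -- Stationarity makes both gradients multiples of their difference `s`.
  set s := gradient f₁ xstar - gradient f₂ xstar with hs
  have hg₁ : gradient f₁ xstar = α₂ • s := by
    have : α₂ • s = (α₁ + α₂) • gradient f₁ xstar
        - (α₁ • gradient f₁ xstar + α₂ • gradient f₂ xstar) := by rw [hs]; module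
    rw [this, hsum, hstat, one_smul, sub_zero]
  have hg₂ : gradient f₂ xstar = (-α₁) • s := by
    have : (-α₁) • s = (α₁ + α₂) • gradient f₂ xstar
        - (α₁ • gradient f₁ xstar + α₂ • gradient f₂ xstar) := by rw [hs]; module
    rw [this, hsum, hstat, one_smul, sub_zero]
  have hsymm : ∀ a b, inner ℝ (H a) b = inner ℝ (H b) a := fun a b => by
    simp only [hH, inner_add_left, real_inner_smul_left]
    rw [inner_fderiv_gradient_comm hf₁ xstar a b, inner_fderiv_gradient_comm hf₂ xstar a b]
  have hHvu : inner ℝ (H v) u = 0 := by rw [hsymm, hu, inner_zero_left]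
  have hsu : inner ℝ s u = 0 := by
    obtain ⟨b₁, b₂, hb⟩ := Submodule.mem_span_pair.mp hvspan
    have hHv : H v = (b₁ * α₂ - b₂ * α₁) • s := by rw [← hb, hg₁, hg₂]; module
    rw [hHv, real_inner_smul_left] at hHvu
    refine (mul_eq_zero.mp hHvu).resolve_left fun h => hv ?_
    rw [hHv, h, zero_smul]
  have hadd : H (v + u) = H v := by
    have : H (v + u) = H v + H u := by simp only [hH, map_add]; module
    rw [this, hu, add_zero]
  have hsvu : inner ℝ s (v + u) = inner ℝ s v := by rw [inner_add_right, hsu, add_zero]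
  have hquad : inner ℝ (H (v + u)) (v + u) = inner ℝ (H v) v := by
    rw [hadd, inner_add_right, hHvu, add_zero]
  simp only [hH, inner_add_left (𝕜 := ℝ) (E := EuclideanSpace ℝ (Fin n)) (_ • _),
    real_inner_smul_left] at hquad
  rw [hg₁, hg₂]
  simp only [real_inner_smul_left, hsvu]
  congr 1
  linear_combination (-(inner ℝ s v)) * hquad
end
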